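/- For every positive integer v and every non-negative integer L, \(\frac{1-q^3}{1-q} \sum_{n_1,\dots,n_v \ge 0} \frac{q^{\sum_{i=1}^v N_i(N_i+2) + n_v}}{(q;q)_{n_1}\cdots(q;q)_{n_{v-1}}\,(q;q)_{2n_v+2}} \cdot \frac{(-1;q^3)_{n_v}}{(-1;q)_{n_v}}\,(1-q^{1+n_v}) \cdot \frac{(q;q)_{2L}}{(q;q)_{L-1-N_1}} = \sum_{j=-\infty}^{\infty} \left(\frac{j}{3}\right) q^{\frac{(2v+1)j^2-3j}{2} - (v-1)} \binom{2L}{L+j}_q\), where the convention \(1/(q;q)_k = 0\) for negative k makes both sums finite. -/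

import Mathlib

open Finset

/-- The finite q-Pochhammer symbol `(a;q)_n`. -/
noncomputable def qPoch (a q : RatFunc ℚ) (n : ℕ) : RatFunc ℚ :=
  ∏ k ∈ Finset.range n, (1 - a * q ^ k)

/-- The q-binomial coefficient `[top choose bot]_q`, zero unless `0 ≤ bot ≤ top`. -/
noncomputable def qBinom (q : RatFunc ℚ) (top bot : ℤ) : RatFunc ℚ :=
  if 0 ≤ bot ∧ bot ≤ top then
    qPoch q q top.toNat / (qPoch q q bot.toNat * qPoch q q (top - bot).toNat)
  else 0

/-- The Legendre symbol modulo 3. -/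
def leg3 (j : ℤ) : ℤ := if j % 3 = 1 then 1 else if j % 3 = 2 then -1 else 0

/-- `1/(q;q)_k`, with the convention that it is zero for negative `k`. -/
noncomputable def invPoch (q : RatFunc ℚ) (k : ℤ) : RatFunc ℚ :=
  if 0 ≤ k then (qPoch q q k.toNat)⁻¹ else 0

/-- The generic variable `q` in the field of rational functions. -/
noncomputable def Xq : RatFunc ℚ := RatFunc.X


lemma Xq_ne : Xq ≠ 0 := RatFunc.X_ne_zero

lemma one_sub_Xq_pow (k : ℕ) (hk : k ≠ 0) : 1 - Xq ^ k ≠ 0 := by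
  intro h
  have h1 : (algebraMap (Polynomial ℚ) (RatFunc ℚ)) (1 - Polynomial.X ^ k) = 0 := by
    simpa [Xq] using h
  rw [map_eq_zero_iff _ (RatFunc.algebraMap_injective ℚ)] at h1
  have h2 := congrArg (Polynomial.eval 2) h1
  simp at h2
  have : (1:ℚ) < 2 ^ k := one_lt_pow₀ (by norm_num) hk
  linarith

lemma one_add_Xq_pow (k : ℕ) : 1 + Xq ^ k ≠ 0 := by
  intro h
  have h1 : (algebraMap (Polynomial ℚ) (RatFunc ℚ)) (1 + Polynomial.X ^ k) = 0 := by
    simpa [Xq] using h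
  rw [map_eq_zero_iff _ (RatFunc.algebraMap_injective ℚ)] at h1
  have h2 := congrArg (Polynomial.eval 1) h1
  norm_num at h2

noncomputable def ee (k : ℤ) : RatFunc ℚ := invPoch Xq k

lemma ee_neg {k : ℤ} (h : k < 0) : ee k = 0 := by
  simp [ee, invPoch, not_le.mpr h]

lemma ee_nat (n : ℕ) : ee (n : ℤ) = (qPoch Xq Xq n)⁻¹ := by
  simp [ee, invPoch]

lemma qP_succ (n : ℕ) : qPoch Xq Xq (n + 1) = qPoch Xq Xq n * (1 - Xq ^ (n + 1)) := by
  simp only [qPoch, Finset.prod_range_succ]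
  rw [pow_succ' Xq n]

lemma qP_ne (n : ℕ) : qPoch Xq Xq n ≠ 0 := by
  induction n with
  | zero => simp [qPoch]
  | succ n ih => rw [qP_succ]; exact mul_ne_zero ih (one_sub_Xq_pow _ (by omega))

lemma ee_rec (k : ℤ) : ee (k - 1) = (1 - Xq ^ k) * ee k := by
  rcases lt_trichotomy k 0 with h | h | h
  · rw [ee_neg h, ee_neg (by omega)]; simp
  · subst h; rw [ee_neg (by omega)]; simp
  · obtain ⟨n, rfl⟩ : ∃ n : ℕ, k = (n : ℤ) + 1 := ⟨(k - 1).toNat, by omega⟩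
    have h1 : ((n : ℤ) + 1) = ((n + 1 : ℕ) : ℤ) := by push_cast; ring
    rw [add_sub_cancel_right, h1, ee_nat, ee_nat, qP_succ, zpow_natCast]
    have := one_sub_Xq_pow (n + 1) (by omega)
    have := qP_ne n
    field_simp

lemma vand (M : ℕ) : ∀ a : ℤ, ∑ s ∈ range (M + 1),
    Xq ^ ((s : ℤ) * (s + a)) * (ee (M - s) * (ee s * ee (s + a))) = ee M * ee (M + a) := by
  induction M with
  | zero => 
    intro a
    have : ee 0 = 1 := by simp [ee, invPoch, qPoch]
    simp [this]
  | succ M ih =>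
    intro a
    have hne := one_sub_Xq_pow (M + 1) (by omega)
    apply mul_left_cancel₀ hne
    have e1 := ee_rec ((M : ℤ) + 1)
    have e2 := ee_rec ((M : ℤ) + 1 + a)
    have hz : (Xq ^ (M + 1) : RatFunc ℚ) = Xq ^ ((M : ℤ) + 1) := by
      rw [← zpow_natCast]; push_cast; rfl
    have key : (1 - Xq ^ (M + 1)) * ∑ s ∈ range (M + 1 + 1),
        Xq ^ ((s : ℤ) * (s + a)) * (ee (((M + 1 : ℕ) : ℤ) - s) * (ee s * ee (s + a)))
        = ∑ s ∈ range (M + 1 + 1),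
            Xq ^ ((s : ℤ) * (s + a)) * (ee ((M : ℤ) - s) * (ee s * ee (s + a)))
          + ∑ s ∈ range (M + 1 + 1), Xq ^ ((M : ℤ) + 1 - s) *
            (Xq ^ ((s : ℤ) * (s + a)) * (ee ((M : ℤ) + 1 - s) * (ee ((s : ℤ) - 1) * ee (s + a)))) := by
      rw [Finset.mul_sum, ← Finset.sum_add_distrib]
      refine Finset.sum_congr rfl fun s _ => ?_
      have f1 := ee_rec ((M : ℤ) + 1 - s)
      rw [show (M : ℤ) + 1 - s - 1 = M - s by ring] at f1
      rw [f1, ee_rec s, hz]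
      have : Xq ^ ((M : ℤ) + 1) = Xq ^ ((M : ℤ) + 1 - s) * Xq ^ (s : ℤ) := by
        rw [← zpow_add₀ Xq_ne]; congr 1; ring
      rw [this]
      push_cast
      ring
    rw [key, Finset.sum_range_succ, ee_neg (show (M : ℤ) - ((M + 1 : ℕ) : ℤ) < 0 by push_cast; omega),
      ih a, Finset.sum_range_succ']
    rw [ee_neg (show ((0 : ℕ) : ℤ) - 1 < 0 by simp)]
    have k2 : ∑ s ∈ range (M + 1), Xq ^ ((M : ℤ) + 1 - (s + 1 : ℕ)) *
            (Xq ^ (((s + 1 : ℕ) : ℤ) * ((s + 1 : ℕ) + a)) * (ee ((M : ℤ) + 1 - (s + 1 : ℕ)) *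
              (ee (((s + 1 : ℕ) : ℤ) - 1) * ee ((s + 1 : ℕ) + a)))) =
          Xq ^ ((M : ℤ) + 1 + a) * (ee M * ee (M + (a + 1))) := by
      rw [← ih (a + 1), Finset.mul_sum]
      refine Finset.sum_congr rfl fun s _ => ?_
      have : Xq ^ ((M : ℤ) + 1 - (s + 1 : ℕ)) * Xq ^ (((s + 1 : ℕ) : ℤ) * ((s + 1 : ℕ) + a))
          = Xq ^ ((M : ℤ) + 1 + a) * Xq ^ ((s : ℤ) * (s + (a + 1))) := by
        rw [← zpow_add₀ Xq_ne, ← zpow_add₀ Xq_ne]; congr 1; push_cast; ring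
      rw [← mul_assoc, this, show (M : ℤ) + 1 - (s + 1 : ℕ) = M - s by push_cast; ring,
        show ((s + 1 : ℕ) : ℤ) - 1 = s by push_cast; ring,
        show ((s + 1 : ℕ) : ℤ) + a = s + (a + 1) by push_cast; ring]
      ring
    rw [k2]
    rw [show (M : ℤ) + 1 - 1 = M by ring] at e1
    rw [show (M : ℤ) + 1 + a - 1 = M + a by ring] at e2
    rw [e1, e2, hz, show (M : ℤ) + (a + 1) = M + 1 + a by ring]
    push_cast
    ring

lemma conj_nat (L m : ℕ) : ∑ r ∈ range (L + 1),
    Xq ^ ((r : ℤ) ^ 2) * (ee (L - r) * (ee (r - m) * ee (r + m))) =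
      Xq ^ ((m : ℤ) ^ 2) * (ee (L - m) * ee (L + m)) := by
  by_cases h : L < m
  · rw [ee_neg (show (L : ℤ) - m < 0 by omega)]
    simp only [zero_mul, mul_zero]
    refine Finset.sum_eq_zero fun r hr => ?_
    rw [Finset.mem_range] at hr
    rw [ee_neg (show (r : ℤ) - m < 0 by omega)]; simp
  · obtain ⟨M, rfl⟩ := Nat.exists_eq_add_of_le (not_lt.mp h)
    rw [add_assoc, Finset.sum_range_add, Finset.sum_eq_zero, zero_add]
    · have := vand M (2 * m)
      rw [show ((m + M : ℕ) : ℤ) - m = M by push_cast; ring,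
        show ((m + M : ℕ) : ℤ) + m = M + 2 * m by push_cast; ring, ← this, Finset.mul_sum]
      refine Finset.sum_congr rfl fun s _ => ?_
      rw [← mul_assoc (Xq ^ ((m : ℤ) ^ 2)), ← zpow_add₀ Xq_ne]
      push_cast
      congr 1
      · congr 1; ring
      · rw [show (m + M : ℤ) - (m + s) = M - s by ring, show (m + s : ℤ) - m = s by ring,
          show (m + s : ℤ) + m = s + 2 * m by ring]
    · intro r hr
      rw [Finset.mem_range] at hr
      rw [ee_neg (show (r : ℤ) - m < 0 by omega)]; simp

lemma conj_int (L : ℕ) (j : ℤ) : ∑ r ∈ range (L + 1),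
    Xq ^ ((r : ℤ) ^ 2) * (ee (L - r) * (ee (r + j) * ee (r - j))) =
      Xq ^ (j ^ 2) * (ee (L + j) * ee (L - j)) := by
  obtain ⟨m, rfl | rfl⟩ := j.eq_nat_or_neg
  · rw [mul_comm (ee ((L : ℤ) + m)), ← conj_nat]
    exact Finset.sum_congr rfl fun r _ => by ring
  · have := conj_nat L m
    simp only [sub_neg_eq_add, neg_sq, ← sub_eq_add_neg]
    exact this

def tt (j : ℤ) : ℤ := (j ^ 2 - 3 * j) / 2 + 1

lemma tt_two (j : ℤ) : 2 * tt j = j ^ 2 - 3 * j + 2 := by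
  have h : (2 : ℤ) ∣ j ^ 2 - 3 * j := by
    rcases Int.even_or_odd' j with ⟨k, rfl | rfl⟩
    · exact ⟨2 * k ^ 2 - 3 * k, by ring⟩
    · exact ⟨2 * k ^ 2 - k - 1, by ring⟩
  unfold tt
  omega

lemma tt_add (j : ℤ) : tt (j + 1) = tt j + j - 1 := by
  have h1 := tt_two j
  have h2 := tt_two (j + 1)
  have : (j + 1) ^ 2 = j ^ 2 + 2 * j + 1 := by ring
  omega

lemma tt_sub (j : ℤ) : tt (j - 1) = tt j - j + 2 := by
  have h1 := tt_two j
  have h2 := tt_two (j - 1)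
  have : (j - 1) ^ 2 = j ^ 2 - 2 * j + 1 := by ring
  omega

noncomputable def RR (v L : ℕ) : RatFunc ℚ :=
  ∑ j ∈ Finset.Icc (-(L : ℤ)) L,
    (leg3 j : RatFunc ℚ) * Xq ^ ((v : ℤ) * (j ^ 2 - 1) + tt j) * (ee (L + j) * ee (L - j))

noncomputable def WW (r : ℕ) (c : ℤ) : RatFunc ℚ :=
  ∑ j ∈ Finset.Icc (-(r : ℤ)) r,
    (leg3 (j + c) : RatFunc ℚ) * Xq ^ (tt j) * (ee (r + j) * ee (r - j))

lemma RR_zero (r : ℕ) : RR 0 r = WW r 0 := by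
  simp [RR, WW]

lemma sum_ext_Icc (r : ℕ) (a b : ℤ) (ha : a ≤ -(r : ℤ)) (hb : (r : ℤ) ≤ b) (f : ℤ → RatFunc ℚ) :
    ∑ j ∈ Finset.Icc (-(r : ℤ)) r, f j * (ee (r + j) * ee (r - j)) =
    ∑ j ∈ Finset.Icc a b, f j * (ee (r + j) * ee (r - j)) := by
  apply Finset.sum_subset (Finset.Icc_subset_Icc ha hb)
  intro j _ hj
  rw [Finset.mem_Icc, not_and_or] at hj
  rcases hj with hj | hj
  · rw [ee_neg (show (r : ℤ) + j < 0 by omega)]; simp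
  · rw [ee_neg (show (r : ℤ) - j < 0 by omega)]; simp

lemma RR_succ (v L : ℕ) : RR (v + 1) L =
    ∑ r ∈ range (L + 1), Xq ^ ((r : ℤ) ^ 2 - 1) * ee (L - r) * RR v r := by
  have h1 : ∀ r ∈ range (L + 1), Xq ^ ((r : ℤ) ^ 2 - 1) * ee (L - r) * RR v r =
      ∑ j ∈ Finset.Icc (-(L : ℤ)) L, Xq ^ ((r : ℤ) ^ 2 - 1) * ee (L - r) *
      ((leg3 j : RatFunc ℚ) * Xq ^ ((v : ℤ) * (j ^ 2 - 1) + tt j) * (ee (r + j) * ee (r - j))) := by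
    intro r hr
    rw [Finset.mem_range] at hr
    rw [RR, sum_ext_Icc r (-(L : ℤ)) L (by omega) (by omega), Finset.mul_sum]
  rw [Finset.sum_congr rfl h1, Finset.sum_comm, RR]
  refine Finset.sum_congr rfl fun j _ => ?_
  have h2 : Xq ^ (((v + 1 : ℕ) : ℤ) * (j ^ 2 - 1) + tt j) =
      Xq ^ ((v : ℤ) * (j ^ 2 - 1) + tt j) * Xq ^ (-1 : ℤ) * Xq ^ (j ^ 2) := by
    rw [← zpow_add₀ Xq_ne, ← zpow_add₀ Xq_ne]; congr 1; push_cast; ring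
  rw [h2]
  calc _ = (leg3 j : RatFunc ℚ) * Xq ^ ((v : ℤ) * (j ^ 2 - 1) + tt j) * Xq ^ (-1 : ℤ) *
        (Xq ^ (j ^ 2) * (ee (L + j) * ee (L - j))) := by ring
    _ = _ := by
      rw [← conj_int, Finset.mul_sum]
      refine Finset.sum_congr rfl fun r _ => ?_
      rw [sub_eq_add_neg ((r : ℤ) ^ 2), zpow_add₀ Xq_ne ((r : ℤ) ^ 2)]
      ring

lemma WW_rec (r : ℕ) (c : ℤ) :
    (1 - Xq ^ (2 * r + 1)) * (1 - Xq ^ (2 * r + 2)) * WW (r + 1) c =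
    (1 + Xq ^ (2 * r + 1)) * WW r c + Xq ^ (r + 2) * WW r (c - 1) +
      Xq ^ ((r : ℤ) - 1) * WW r (c + 1) := by
  have s1 : WW r c = ∑ j ∈ Finset.Icc (-(r + 1 : ℕ) : ℤ) ((r + 1 : ℕ) : ℤ),
      (leg3 (j + c) : RatFunc ℚ) * Xq ^ (tt j) * (ee (r + j) * ee (r - j)) :=
    sum_ext_Icc r _ _ (by push_cast; omega) (by push_cast; omega) _
  have s2 : WW r (c - 1) = ∑ j ∈ Finset.Icc (-(r + 1 : ℕ) : ℤ) ((r + 1 : ℕ) : ℤ),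
      (leg3 ((j + 1) + (c - 1)) : RatFunc ℚ) * Xq ^ (tt (j + 1)) *
        (ee (r + (j + 1)) * ee (r - (j + 1))) := by
    rw [WW, sum_ext_Icc r (-(r + 1 : ℕ) + 1 : ℤ) ((r + 1 : ℕ) + 1 : ℤ)
      (by push_cast; omega) (by push_cast; omega), ← Finset.image_add_right_Icc,
      Finset.sum_image (by intro a _ b _ h; simpa using h)]
  have s3 : WW r (c + 1) = ∑ j ∈ Finset.Icc (-(r + 1 : ℕ) : ℤ) ((r + 1 : ℕ) : ℤ),
      (leg3 ((j + -1) + (c + 1)) : RatFunc ℚ) * Xq ^ (tt (j + -1)) *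
        (ee (r + (j + -1)) * ee (r - (j + -1))) := by
    rw [WW, sum_ext_Icc r (-(r + 1 : ℕ) + -1 : ℤ) ((r + 1 : ℕ) + -1 : ℤ)
      (by push_cast; omega) (by push_cast; omega), ← Finset.image_add_right_Icc,
      Finset.sum_image (by intro a _ b _ h; simpa using h)]
  rw [s1, s2, s3, WW, Finset.mul_sum, Finset.mul_sum, Finset.mul_sum, Finset.mul_sum,
    ← Finset.sum_add_distrib, ← Finset.sum_add_distrib]
  refine Finset.sum_congr rfl fun j _ => ?_
  rw [show j + 1 + (c - 1) = j + c by ring, show j + -1 + (c + 1) = j + c by ring,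
    ← sub_eq_add_neg, tt_add, tt_sub]
  have a1 := ee_rec ((r : ℤ) + 1 + j)
  have a2 := ee_rec ((r : ℤ) + j)
  have b1 := ee_rec ((r : ℤ) + 1 - j)
  have b2 := ee_rec ((r : ℤ) - j)
  rw [show (r : ℤ) + 1 + j - 1 = r + j by ring] at a1
  rw [show (r : ℤ) + 1 - j - 1 = r - j by ring] at b1
  rw [show ((r + 1 : ℕ) : ℤ) + j = r + 1 + j by push_cast; ring,
    show ((r + 1 : ℕ) : ℤ) - j = r + 1 - j by push_cast; ring,
    show (r : ℤ) + (j + 1) = r + 1 + j by ring, show (r : ℤ) - (j + 1) = r - j - 1 by ring,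
    show (r : ℤ) + (j - 1) = r + j - 1 by ring, show (r : ℤ) - (j - 1) = r + 1 - j by ring,
    a2, b2, a1, b1]
  have hx := Xq_ne
  have hy : Xq ^ j ≠ 0 := zpow_ne_zero _ hx
  simp only [sub_eq_add_neg, zpow_add₀ hx, zpow_neg, zpow_natCast, zpow_one, pow_add, pow_mul,
    ]
  simp only [zpow_ofNat]
  generalize Xq ^ j = y at *
  generalize (Xq ^ tt j) = z
  field_simp
  ring

lemma leg_per (j : ℤ) : leg3 (j - 1) = leg3 (j + 2) := by
  unfold leg3
  rw [show j + 2 = j - 1 + 3 by ring, Int.add_emod_right]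

lemma leg_sum (j : ℤ) : leg3 j + leg3 (j + 1) + leg3 (j + 2) = 0 := by
  unfold leg3
  split_ifs <;> omega

lemma WW_two (r : ℕ) : WW r 2 = - WW r 0 - WW r 1 := by
  have : WW r 0 + WW r 1 + WW r 2 = 0 := by
    rw [WW, WW, WW, ← Finset.sum_add_distrib, ← Finset.sum_add_distrib]
    refine Finset.sum_eq_zero fun j _ => ?_
    have h : ((leg3 j + leg3 (j + 1) + leg3 (j + 2) : ℤ) : RatFunc ℚ) = 0 := by
      rw [leg_sum]; simp
    push_cast at h
    rw [add_zero]
    linear_combination (Xq ^ tt j * (ee (r + j) * ee (r - j))) * h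
  linear_combination this

lemma WW_neg (r : ℕ) : WW r (0 - 1) = WW r 2 := by
  rw [WW, WW]
  refine Finset.sum_congr rfl fun j _ => ?_
  rw [← leg_per, zero_sub, ← sub_eq_add_neg]

noncomputable def pp (n : ℕ) : RatFunc ℚ := qPoch (-1) (Xq ^ 3) n / qPoch (-1) Xq n

lemma qPm_ne (n : ℕ) : qPoch (-1) Xq n ≠ 0 := by
  unfold qPoch
  rw [Finset.prod_ne_zero_iff]
  intro k _
  have := one_add_Xq_pow k
  simpa using this

lemma pp_succ (n : ℕ) : pp (n + 1) = pp n * (1 - Xq ^ n + Xq ^ (2 * n)) := by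
  have h1 := qPm_ne n
  have h2 := one_add_Xq_pow n
  have e1 : qPoch (-1) Xq (n + 1) = qPoch (-1) Xq n * (1 + Xq ^ n) := by
    simp [qPoch, Finset.prod_range_succ]
  have e2 : qPoch (-1) (Xq ^ 3) (n + 1) = qPoch (-1) (Xq ^ 3) n * (1 + (Xq ^ n) ^ 3) := by
    simp [qPoch, Finset.prod_range_succ, ← pow_mul, mul_comm]
  rw [pp, pp, e1, e2, pow_mul' Xq 2]
  field_simp
  ring

lemma WW_closed (n : ℕ) :
    qPoch Xq Xq (2 * n + 2) * WW (n + 1) 0 =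
      pp n * ((1 + Xq + Xq ^ 2) * Xq ^ n * (1 - Xq ^ (n + 1))) ∧
    qPoch Xq Xq (2 * n + 2) * WW (n + 1) 1 =
      pp n * ((1 + Xq + Xq ^ 2) * Xq ^ (2 * n + 1) - Xq ^ (3 * n + 3) - 1) := by
  induction n with
  | zero =>
    have hI : Finset.Icc (-((0 + 1 : ℕ) : ℤ)) ((0 + 1 : ℕ) : ℤ) = {-1, 0, 1} := by decide
    have h0 : ee 0 = 1 := by simp [ee, invPoch, qPoch]
    have h1 := qP_succ 0
    have h2 := qP_succ 1
    have h3 : qPoch Xq Xq 0 = 1 := by simp [qPoch]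
    have g1 : ee 1 = (qPoch Xq Xq 1)⁻¹ := ee_nat 1
    have g2 : ee 2 = (qPoch Xq Xq 2)⁻¹ := ee_nat 2
    have n1 := one_sub_Xq_pow 1 (by norm_num)
    have n2 := one_sub_Xq_pow 2 (by norm_num)
    have l1 : leg3 (-1) = -1 := by decide
    have l2 : leg3 0 = 0 := by decide
    have l3 : leg3 1 = 1 := by decide
    have l4 : leg3 2 = -1 := by decide
    have t1 : tt (-1) = 3 := by decide
    have t2 : tt 0 = 1 := by decide
    have t3 : tt 1 = 0 := by decide
    have p0 : pp 0 = 1 := by simp [pp, qPoch]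
    norm_num at h1 h2 n1
    rw [h3, one_mul] at h1
    rw [h1] at h2 g1
    rw [h2] at g2
    constructor
    · rw [WW, hI]
      norm_num [l1, l2, l3, l4, t1, t2, t3, h0, g1, g2, h2, p0]
      field_simp
      ring
    · rw [WW, hI]
      norm_num [l1, l2, l3, l4, t1, t2, t3, h0, g1, g2, h2, p0]
      field_simp
      ring
  | succ n ih =>
    obtain ⟨i0, i1⟩ := ih
    have r0 := WW_rec (n + 1) 0
    have r1 := WW_rec (n + 1) 1
    rw [WW_neg, WW_two, zero_add] at r0
    rw [show (1 : ℤ) - 1 = 0 by norm_num, show (1 : ℤ) + 1 = 2 by norm_num, WW_two] at r1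
    have hq : qPoch Xq Xq (2 * (n + 1) + 2) = qPoch Xq Xq (2 * n + 2) *
        ((1 - Xq ^ (2 * (n + 1) + 1)) * (1 - Xq ^ (2 * (n + 1) + 2))) := by
      rw [show 2 * (n + 1) + 2 = (2 * n + 2) + 1 + 1 by ring, qP_succ, qP_succ,
        show 2 * (n + 1) + 1 = 2 * n + 2 + 1 by ring]
      ring
    have hz : Xq ^ (((n + 1 : ℕ) : ℤ) - 1) = Xq ^ n := by
      rw [← zpow_natCast]; congr 1; push_cast; ring
    rw [hz] at r0 r1
    rw [hq, mul_assoc (qPoch Xq Xq _), r0, mul_assoc (qPoch Xq Xq _), r1, pp_succ]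
    constructor
    · linear_combination ((1 + Xq ^ (2 * (n + 1) + 1)) - Xq ^ (n + 1 + 2)) * i0 +
        (Xq ^ n - Xq ^ (n + 1 + 2)) * i1
    · linear_combination (Xq ^ (n + 1 + 2) - Xq ^ n) * i0 +
        ((1 + Xq ^ (2 * (n + 1) + 1)) - Xq ^ n) * i1

noncomputable def HH (w : ℕ) (n : Fin (w + 1) → ℕ) : RatFunc ℚ :=
  Xq ^ (∑ i : Fin (w + 1), (∑ k ∈ Finset.Ici i, n k) * ((∑ k ∈ Finset.Ici i, n k) + 2) +
      n (Fin.last w)) *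
    (∏ i ∈ Finset.univ.erase (Fin.last w), qPoch Xq Xq (n i))⁻¹ *
    (qPoch Xq Xq (2 * n (Fin.last w) + 2))⁻¹ *
    pp (n (Fin.last w)) * (1 - Xq ^ (1 + n (Fin.last w)))

lemma HH_cons (w : ℕ) (a : ℕ) (n : Fin (w + 1) → ℕ) :
    HH (w + 1) (Fin.cons a n) =
      Xq ^ ((a + ∑ k, n k) * ((a + ∑ k, n k) + 2)) * ee a * HH w n := by
  have hl : (Fin.cons a n : Fin (w + 2) → ℕ) (Fin.last (w + 1)) = n (Fin.last w) := by
    rw [← Fin.succ_last, Fin.cons_succ]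
  have h0 : ∑ k ∈ Finset.Ici (0 : Fin (w + 2)), (Fin.cons a n : Fin (w + 2) → ℕ) k
      = a + ∑ k, n k := by
    have : Finset.Ici (0 : Fin (w + 2)) = Finset.univ := by ext x; simp
    rw [this, Fin.sum_univ_succ]; simp
  have hs : ∀ i : Fin (w + 1), ∑ k ∈ Finset.Ici i.succ, (Fin.cons a n : Fin (w + 2) → ℕ) k
      = ∑ k ∈ Finset.Ici i, n k := by
    intro i
    have : Finset.Ici i.succ = (Finset.Ici i).map (Fin.succEmb (w + 1)) := by
      simp
    rw [this, Finset.sum_map]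
    simp
  have hp : ∏ i ∈ Finset.univ.erase (Fin.last (w + 1)),
      qPoch Xq Xq ((Fin.cons a n : Fin (w + 2) → ℕ) i) =
      qPoch Xq Xq a * ∏ i ∈ Finset.univ.erase (Fin.last w), qPoch Xq Xq (n i) := by
    apply mul_left_cancel₀ (qP_ne (n (Fin.last w)))
    conv_lhs => rw [← hl]
    rw [Finset.mul_prod_erase Finset.univ
      (fun i => qPoch Xq Xq ((Fin.cons a n : Fin (w + 2) → ℕ) i)) (Finset.mem_univ _),
      mul_left_comm, Finset.mul_prod_erase Finset.univ
      (fun i => qPoch Xq Xq (n i)) (Finset.mem_univ _), Fin.prod_univ_succ]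
    simp
  rw [HH, HH, hl, hp, Fin.sum_univ_succ, h0, ee_nat]
  simp only [hs]
  rw [add_assoc, pow_add, mul_inv]
  ring

lemma shift_sum (N B L : ℕ) (h : L ≤ B) :
    ∑ a ∈ range B, Xq ^ ((a + N) * ((a + N) + 2)) * ee a * ee ((L : ℤ) - 1 - ((a + N : ℕ) : ℤ)) =
    ∑ r ∈ range (L + 1), Xq ^ ((r : ℤ) ^ 2 - 1) * ee (L - r) * ee ((r : ℤ) - 1 - N) := by
  have : ∑ r ∈ range (L + 1), Xq ^ ((r : ℤ) ^ 2 - 1) * ee (L - r) * ee ((r : ℤ) - 1 - N) =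
      ∑ r ∈ range ((1 + N) + B), Xq ^ ((r : ℤ) ^ 2 - 1) * ee (L - r) * ee ((r : ℤ) - 1 - N) := by
    apply Finset.sum_subset
    · intro x hx
      rw [Finset.mem_range] at *
      omega
    · intro r _ hr
      rw [Finset.mem_range] at hr
      rw [ee_neg (show (L : ℤ) - r < 0 by omega)]; simp
  rw [this, Finset.sum_range_add, Finset.sum_eq_zero (s := range (1 + N)), zero_add]
  · refine Finset.sum_congr rfl fun a _ => ?_
    rw [← zpow_natCast]
    push_cast
    rw [show (L : ℤ) - 1 - (a + N) = L - (1 + N + a) by ring,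
      show (1 + N + a : ℤ) - 1 - N = a by ring,
      show (1 + N + a : ℤ) ^ 2 - 1 = (a + N) * (a + N + 2) by ring]
    ring
  · intro r hr
    rw [Finset.mem_range] at hr
    rw [ee_neg (show (r : ℤ) - 1 - N < 0 by omega)]; simp

lemma main_ind (w : ℕ) : ∀ B L : ℕ, L ≤ B →
    ((1 - Xq ^ 3) / (1 - Xq)) * ∑ n ∈ Fintype.piFinset (fun _ : Fin (w + 1) => Finset.range B),
      HH w n * ee ((L : ℤ) - 1 - ((∑ k, n k : ℕ) : ℤ)) = RR (w + 1) L := by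
  have hC : (1 - Xq ^ 3) / (1 - Xq) = 1 + Xq + Xq ^ 2 := by
    have := one_sub_Xq_pow 1 (by norm_num)
    rw [pow_one] at this
    field_simp
    ring
  induction w with
  | zero =>
    intro B L h
    rw [hC, RR_succ, Finset.sum_range_succ']
    have z : RR 0 0 = 0 := by
      have : leg3 0 = 0 := by decide
      simp [RR, this]
    rw [z, mul_zero, add_zero]
    have e : ∑ n ∈ Fintype.piFinset (fun _ : Fin (0 + 1) => Finset.range B),
      HH 0 n * ee ((L : ℤ) - 1 - ((∑ k, n k : ℕ) : ℤ)) =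
      ∑ a ∈ range B, HH 0 (fun _ => a) * ee ((L : ℤ) - 1 - (a : ℤ)) := by
      symm
      refine Finset.sum_bij (fun a _ => fun _ => a) ?_ ?_ ?_ ?_
      · intro a ha
        simpa using ha
      · intro a _ b _ hab
        exact congrFun hab 0
      · intro n hn
        refine ⟨n 0, ?_, ?_⟩
        · simpa using (Fintype.mem_piFinset.mp hn) 0
        · funext i; congr 1; exact Fin.ext (by omega)
      · intro a _
        simp
    rw [e, Finset.mul_sum]
    symm
    have e2 : ∀ a : ℕ, Xq ^ (((a + 1 : ℕ) : ℤ) ^ 2 - 1) * ee (L - ((a + 1 : ℕ) : ℤ)) * RR 0 (a + 1) =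
        (1 + Xq + Xq ^ 2) * (HH 0 (fun _ => a) * ee ((L : ℤ) - 1 - (a : ℤ))) := by
      intro a
      have hw := (WW_closed a).1
      have hq := qP_ne (2 * a + 2)
      have hW : WW (a + 1) 0 = (qPoch Xq Xq (2 * a + 2))⁻¹ *
        (pp a * ((1 + Xq + Xq ^ 2) * Xq ^ a * (1 - Xq ^ (a + 1)))) := by
        rw [← hw]; field_simp
      have hH : HH 0 (fun _ => a) = Xq ^ (a * (a + 2) + a) * (qPoch Xq Xq (2 * a + 2))⁻¹ *
          pp a * (1 - Xq ^ (1 + a)) := by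
        have i0 : Finset.Ici (0 : Fin (0 + 1)) = {0} := by decide
        have i1 : (Finset.univ.erase (Fin.last 0) : Finset (Fin (0 + 1))) = ∅ := by decide
        rw [HH, i1]
        simp [i0]
      have hz : Xq ^ (((a + 1 : ℕ) : ℤ) ^ 2 - 1) = Xq ^ (a * (a + 2)) := by
        rw [← zpow_natCast]; congr 1; push_cast; ring
      rw [RR_zero, hW, hH, hz, show (L : ℤ) - ((a + 1 : ℕ) : ℤ) = L - 1 - a by push_cast; ring,
        pow_add _ (a * (a + 2)), add_comm 1 a]
      ring
    rw [Finset.sum_congr rfl fun a _ => e2 a]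
    apply Finset.sum_subset
    · intro x hx
      rw [Finset.mem_range] at *
      omega
    · intro a _ ha
      rw [Finset.mem_range] at ha
      rw [ee_neg (show (L : ℤ) - 1 - a < 0 by omega)]; simp
  | succ w ih =>
    intro B L h
    have e : ∑ n ∈ Fintype.piFinset (fun _ : Fin (w + 1 + 1) => Finset.range B),
        HH (w + 1) n * ee ((L : ℤ) - 1 - ((∑ k, n k : ℕ) : ℤ)) =
      ∑ p ∈ range B ×ˢ Fintype.piFinset (fun _ : Fin (w + 1) => Finset.range B),
        HH (w + 1) (Fin.cons p.1 p.2) * ee ((L : ℤ) - 1 - ((p.1 + ∑ k, p.2 k : ℕ) : ℤ)) := by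
      symm
      refine Finset.sum_bij (fun p _ => (Fin.cons p.1 p.2 : Fin (w + 1 + 1) → ℕ)) ?_ ?_ ?_ ?_
      · intro p hp
        rw [Finset.mem_product, Fintype.mem_piFinset] at hp
        rw [Fintype.mem_piFinset]
        intro i
        refine Fin.cases ?_ (fun i => ?_) i
        · simpa using hp.1
        · simpa using hp.2 i
      · intro a _ b _ hab
        obtain ⟨h1, h2⟩ := Fin.cons_injective2 hab
        exact Prod.ext h1 h2
      · intro n hn
        rw [Fintype.mem_piFinset] at hn
        refine ⟨(n 0, Fin.tail n), ?_, ?_⟩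
        · rw [Finset.mem_product, Fintype.mem_piFinset]
          exact ⟨hn 0, fun i => hn i.succ⟩
        · exact Fin.cons_self_tail n
      · intro p _
        rw [Fin.sum_univ_succ (fun k => (Fin.cons p.1 p.2 : Fin (w + 1 + 1) → ℕ) k)]
        simp
    rw [e, Finset.sum_product_right, RR_succ]
    have e2 : ∀ n : Fin (w + 1) → ℕ, ∑ a ∈ range B,
        HH (w + 1) (Fin.cons a n) * ee ((L : ℤ) - 1 - ((a + ∑ k, n k : ℕ) : ℤ)) =
        ∑ r ∈ range (L + 1), Xq ^ ((r : ℤ) ^ 2 - 1) * ee (L - r) *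
          (HH w n * ee ((r : ℤ) - 1 - ((∑ k, n k : ℕ) : ℤ))) := by
      intro n
      have := congrArg (fun x => HH w n * x) (shift_sum (∑ k, n k) B L h)
      simp only [Finset.mul_sum] at this
      rw [Finset.sum_congr rfl fun a _ => by rw [HH_cons]]
      refine Eq.trans (Finset.sum_congr rfl fun a _ => ?_)
        (this.trans (Finset.sum_congr rfl fun r _ => ?_)) <;> ring
    simp only [e2]
    rw [Finset.sum_comm, Finset.mul_sum]
    refine Finset.sum_congr rfl fun r hr => ?_
    rw [Finset.mem_range] at hr
    rw [← ih B r (by omega), ← Finset.mul_sum]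
    ring

/-- Identity (2.4): for `v ≥ 1` and `L ≥ 0`, writing `N_i = n_i + ⋯ + n_v`,
`(1-q³)/(1-q) · ∑_{n_1,…,n_v ≥ 0} q^{∑ N_i(N_i+2) + n_v}
    / ((q;q)_{n_1} ⋯ (q;q)_{n_{v-1}} (q;q)_{2n_v+2})
    · ((-1;q³)_{n_v}/(-1;q)_{n_v}) (1-q^{1+n_v}) (q;q)_{2L}/(q;q)_{L-1-N_1}
  = ∑_j (j/3) q^{((2v+1)j²-3j)/2 - (v-1)} [2L choose L+j]_q`,
where `1/(q;q)_k = 0` for negative `k`; the multi-sum is taken over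
`0 ≤ n_i ≤ L`, which covers all nonzero terms. -/
theorem statement12 (v : ℕ) (hv : 0 < v) (L : ℕ) :
    ((1 - Xq ^ 3) / (1 - Xq)) *
      ∑ n ∈ Fintype.piFinset (fun _ : Fin v => Finset.range (L + 1)),
        Xq ^ (∑ i : Fin v,
              (∑ k ∈ Finset.Ici i, n k) * ((∑ k ∈ Finset.Ici i, n k) + 2) +
            n ⟨v - 1, by omega⟩) *
          (∏ i ∈ Finset.univ.erase (⟨v - 1, by omega⟩ : Fin v), qPoch Xq Xq (n i))⁻¹ *
          (qPoch Xq Xq (2 * n ⟨v - 1, by omega⟩ + 2))⁻¹ *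
          (qPoch (-1) (Xq ^ 3) (n ⟨v - 1, by omega⟩) / qPoch (-1) Xq (n ⟨v - 1, by omega⟩)) *
          (1 - Xq ^ (1 + n ⟨v - 1, by omega⟩)) *
          qPoch Xq Xq (2 * L) * invPoch Xq ((L : ℤ) - 1 - ∑ k : Fin v, n k) =
    ∑ j ∈ Finset.Icc (-(L : ℤ)) (L : ℤ),
      (leg3 j : RatFunc ℚ) *
        Xq ^ (((2 * (v : ℤ) + 1) * j ^ 2 - 3 * j) / 2 - ((v : ℤ) - 1)) *
        qBinom Xq (2 * L) ((L : ℤ) + j) := by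
  obtain ⟨w, rfl⟩ : ∃ w, v = w + 1 := ⟨v - 1, by omega⟩
  have hm := main_ind w (L + 1) L (by omega)
  have hr : ∑ j ∈ Finset.Icc (-(L : ℤ)) (L : ℤ),
      (leg3 j : RatFunc ℚ) *
        Xq ^ (((2 * ((w + 1 : ℕ) : ℤ) + 1) * j ^ 2 - 3 * j) / 2 - (((w + 1 : ℕ) : ℤ) - 1)) *
        qBinom Xq (2 * L) ((L : ℤ) + j) = qPoch Xq Xq (2 * L) * RR (w + 1) L := by
    rw [RR, Finset.mul_sum]
    refine Finset.sum_congr rfl fun j hj => ?_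
    rw [Finset.mem_Icc] at hj
    have hb : qBinom Xq (2 * L) ((L : ℤ) + j) =
        qPoch Xq Xq (2 * L) * (ee (L + j) * ee (L - j)) := by
      rw [qBinom, if_pos (by omega), ee, ee, invPoch, invPoch, if_pos (by omega),
        if_pos (by omega), show (2 * (L : ℤ)).toNat = 2 * L by omega,
        show 2 * (L : ℤ) - (L + j) = L - j by ring, div_eq_mul_inv, mul_inv]
    have he : ((2 * ((w + 1 : ℕ) : ℤ) + 1) * j ^ 2 - 3 * j) / 2 - (((w + 1 : ℕ) : ℤ) - 1) =
        ((w + 1 : ℕ) : ℤ) * (j ^ 2 - 1) + tt j := by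
      rw [show (2 * ((w + 1 : ℕ) : ℤ) + 1) * j ^ 2 - 3 * j =
        (j ^ 2 - 3 * j) + 2 * (((w + 1 : ℕ) : ℤ) * j ^ 2) by ring,
        Int.add_mul_ediv_left _ _ (by norm_num), tt]
      ring
    rw [hb, he]
    ring
  rw [hr, ← hm, mul_left_comm, Finset.mul_sum _ _ (qPoch Xq Xq (2 * L))]
  congr 1
  refine Finset.sum_congr rfl fun n _ => ?_
  have hl : (⟨w + 1 - 1, by omega⟩ : Fin (w + 1)) = Fin.last w := rfl
  rw [HH, pp, ee]
  simp only [hl]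
  push_cast
  ring
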